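/- arXiv:2409.07029 — 4 statements merged into one kernel-verified Lean document; each statement's English description precedes it below -/
import Mathlib

section
/- Let H ∈ (1/2,1) and t ≥ 0. Then the function M_t defined by M_t(x) = C_H ∫_ℝ χ_{[0,t]}(x+y)|y|^{H−3/2} dy is square-integrable on ℝ: ∫_ℝ M_t(x)² dx < ∞. -/
open MeasureTheory Real

noncomputable section

/-- The normalizing constant `C_H = [2Γ(H−1/2)cos(π(H−1/2)/2)]⁻¹`. -/
def fracC (H : ℝ) : ℝ :=
  (2 * Real.Gamma (H - 1/2) * Real.cos (Real.pi / 2 * (H - 1/2)))⁻¹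

/-- `M_t(x) = C_H ∫_ℝ χ_{[0,t]}(x+y)|y|^{H−3/2} dy`, the image of the indicator of `[0,t]`
under the fractional integral operator `M` of order `H−1/2`. -/
def fracMt (H t x : ℝ) : ℝ :=
  fracC H * ∫ y : ℝ, Set.indicator (Set.Icc 0 t) (fun _ => (1:ℝ)) (x + y) * |y| ^ (H - 3/2)

/-- `|y| ^ a` is integrable on every interval around the origin when `-1 < a`. -/
theorem integrableOn_abs_rpow_Icc {a : ℝ} (ha : -1 < a) {R : ℝ} (hR : 0 ≤ R) :
    IntegrableOn (fun y : ℝ => |y| ^ a) (Set.Icc (-R) R) := by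
  have hpos : IntervalIntegrable (fun y : ℝ => |y| ^ a) volume 0 R := by
    refine (intervalIntegral.intervalIntegrable_rpow' (a := 0) (b := R) ha).congr fun y hy => ?_
    rw [Set.uIoc_of_le hR] at hy
    simp only [abs_of_pos hy.1]
  have hneg : IntervalIntegrable (fun y : ℝ => |y| ^ a) volume (-R) 0 := by
    simpa using ((IntervalIntegrable.iff_comp_neg).1 hpos).symm
  rw [integrableOn_Icc_iff_integrableOn_Ioc,
    ← intervalIntegrable_iff_integrableOn_Ioc_of_le (by linarith)]
  exact hneg.trans hpos

/-- The unnormalized integral in `fracMt` is an integral over `[-x, t - x]`. -/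
theorem integral_indicator_add_mul_abs_rpow (a t x : ℝ) :
    ∫ y : ℝ, Set.indicator (Set.Icc 0 t) (fun _ => (1 : ℝ)) (x + y) * |y| ^ a =
      ∫ y in Set.Icc (-x) (t - x), |y| ^ a := by
  rw [← integral_indicator measurableSet_Icc]
  congr 1 with y
  have h : x + y ∈ Set.Icc 0 t ↔ y ∈ Set.Icc (-x) (t - x) := by
    simp only [Set.mem_Icc]
    constructor <;> rintro ⟨h₁, h₂⟩ <;> constructor <;> linarith
  by_cases hy : y ∈ Set.Icc (-x) (t - x)
  · rw [Set.indicator_of_mem hy, Set.indicator_of_mem (h.2 hy), one_mul]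
  · rw [Set.indicator_of_notMem hy, Set.indicator_of_notMem (mt h.1 hy), zero_mul]

/-- The integral of `|y| ^ a` over `[-x, t - x]` decays like `|x| ^ a`. -/
theorem exists_setIntegral_abs_rpow_le {a : ℝ} (ha : -1 < a) (ha0 : a ≤ 0) {t : ℝ} (ht : 0 ≤ t) :
    ∃ D : ℝ, ∀ x : ℝ, ∫ y in Set.Icc (-x) (t - x), |y| ^ a ≤ D * (1 + |x|) ^ a := by
  set K : ℝ := ∫ y in Set.Icc (-(3 * t + 1)) (3 * t + 1), |y| ^ a with hK
  have hK0 : 0 ≤ K := integral_nonneg fun y => by positivity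
  have h2 : (0 : ℝ) < 2 ^ a := by positivity
  have ht2 : 0 < (2 * t + 2) ^ a := by positivity
  refine ⟨K / (2 * t + 2) ^ a + t / 2 ^ a, fun x => ?_⟩
  have hx : 0 < 1 + |x| := by positivity
  have hxa : 0 < (1 + |x|) ^ a := by positivity
  rw [add_mul]
  rcases le_or_gt |x| (2 * t + 1) with hxt | hxt
  · have hsub : Set.Icc (-x) (t - x) ⊆ Set.Icc (-(3 * t + 1)) (3 * t + 1) := by
      obtain ⟨h₁, h₂⟩ := abs_le.1 hxt
      exact Set.Icc_subset_Icc (by linarith) (by linarith)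
    have hle : ∫ y in Set.Icc (-x) (t - x), |y| ^ a ≤ K :=
      setIntegral_mono_set (integrableOn_abs_rpow_Icc ha (by positivity))
        (Filter.Eventually.of_forall fun y => by positivity) hsub.eventuallyLE
    have hmono : (2 * t + 2) ^ a ≤ (1 + |x|) ^ a :=
      rpow_le_rpow_of_nonpos hx (by linarith) ha0
    have hK' : K ≤ K / (2 * t + 2) ^ a * (1 + |x|) ^ a := by
      rw [div_mul_eq_mul_div, le_div_iff₀ ht2]
      gcongr
    have : 0 ≤ t / 2 ^ a * (1 + |x|) ^ a := by positivity
    linarith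
  · have hbound : ∀ y ∈ Set.Icc (-x) (t - x), ‖|y| ^ a‖ ≤ ((1 + |x|) / 2) ^ a := by
      intro y hy
      rw [norm_of_nonneg (by positivity)]
      refine rpow_le_rpow_of_nonpos (by positivity) ?_ ha0
      have hxy : |x + y| ≤ t := abs_le.2 ⟨by linarith [hy.1], by linarith [hy.2]⟩
      have := abs_sub (x + y) y
      rw [add_sub_cancel_right] at this
      linarith
    have hle := norm_setIntegral_le_of_norm_le_const (μ := volume) (by simp) hbound
    rw [Real.volume_real_Icc_of_le (by linarith), div_rpow hx.le (by norm_num)] at hle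
    have h := (le_abs_self _).trans hle
    have heq : (1 + |x|) ^ a / 2 ^ a * (t - x - -x) = t / 2 ^ a * (1 + |x|) ^ a := by ring
    rw [heq] at h
    have : 0 ≤ K / (2 * t + 2) ^ a * (1 + |x|) ^ a := by positivity
    linarith

/-- For `H ∈ (1/2,1)` and `t ≥ 0`, the function `M_t` is square-integrable on `ℝ`:
`∫_ℝ M_t(x)² dx < ∞`. -/
theorem fracMt_sq_integrable (H : ℝ) (hH : H ∈ Set.Ioo (1/2 : ℝ) 1) (t : ℝ) (ht : 0 ≤ t) :
    ∫⁻ x : ℝ, ENNReal.ofReal ((fracMt H t x)^2) < ⊤ := by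
  obtain ⟨hH₁, hH₂⟩ := hH
  obtain ⟨D, hD⟩ :=
    exists_setIntegral_abs_rpow_le (a := H - 3 / 2) (by linarith) (by linarith) ht
  have hint : Integrable (fun x : ℝ => (1 + ‖x‖) ^ (-(3 - 2 * H))) :=
    integrable_one_add_norm (by simp only [Module.finrank_self, Nat.cast_one]; linarith)
  refine lt_of_le_of_lt (lintegral_mono fun x => ENNReal.ofReal_le_ofReal ?_)
    (hint.const_mul ((fracC H * D) ^ 2)).lintegral_lt_top
  have hx : 0 ≤ 1 + |x| := by positivity
  have hpow : (1 + |x|) ^ (-(3 - 2 * H)) = ((1 + |x|) ^ (H - 3 / 2)) ^ 2 := by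
    rw [← rpow_natCast, ← rpow_mul hx]
    congr 1
    push_cast
    ring
  have hnonneg : 0 ≤ ∫ y in Set.Icc (-x) (t - x), |y| ^ (H - 3 / 2) :=
    integral_nonneg fun y => by positivity
  rw [fracMt, integral_indicator_add_mul_abs_rpow, norm_eq_abs, hpow]
  calc (fracC H * ∫ y in Set.Icc (-x) (t - x), |y| ^ (H - 3 / 2)) ^ 2
      = fracC H ^ 2 * (∫ y in Set.Icc (-x) (t - x), |y| ^ (H - 3 / 2)) ^ 2 := mul_pow _ _ _
    _ ≤ fracC H ^ 2 * (D * (1 + |x|) ^ (H - 3 / 2)) ^ 2 := by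
        gcongr
        exact hD x
    _ = (fracC H * D) ^ 2 * ((1 + |x|) ^ (H - 3 / 2)) ^ 2 := by ring
end
end

section
/- Let H ∈ (1/2,1), set K_H = ∫_ℝ M_1(x)² dx, and let 0 ≤ s ≤ t. Then ∫_ℝ M_s(x) M_t(x) dx = (K_H/2) ( s^{2H} + t^{2H} − (t−s)^{2H} ). -/
open MeasureTheory Real

noncomputable section

theorem integrableOn_abs_rpow {p : ℝ} (hp : -1 < p) (a b : ℝ) :
    IntegrableOn (fun y : ℝ => |y| ^ p) (Set.Icc a b) := by
  have hpos (c : ℝ) (hc : 0 ≤ c) : IntervalIntegrable (fun y : ℝ => |y| ^ p) volume 0 c := by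
    refine (intervalIntegral.intervalIntegrable_rpow' hp (a := 0) (b := c)).congr fun y hy => ?_
    rw [Set.uIoc_of_le hc] at hy
    simp only [abs_of_pos hy.1]
  have hall (c : ℝ) : IntervalIntegrable (fun y : ℝ => |y| ^ p) volume 0 c := by
    rcases le_total 0 c with hc | hc
    · exact hpos c hc
    · have h := (hpos (-c) (by linarith)).comp_sub_left 0
      simpa using h
  rcases le_total a b with hab | hab
  · exact (intervalIntegrable_iff_integrableOn_Icc_of_le hab).1 ((hall a).symm.trans (hall b))
  · exact (IntegrableOn.of_measure_zero (by simp [hab]))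

theorem indicator_Icc_add_mul_eq (p t x : ℝ) :
    (fun y : ℝ => Set.indicator (Set.Icc 0 t) (fun _ => (1:ℝ)) (x + y) * |y| ^ p)
      = Set.indicator (Set.Icc (-x) (t - x)) (fun y => |y| ^ p) := by
  funext y
  have : x + y ∈ Set.Icc 0 t ↔ y ∈ Set.Icc (-x) (t - x) := by
    simp only [Set.mem_Icc]
    constructor <;> rintro ⟨h₁, h₂⟩ <;> constructor <;> linarith
  by_cases h : y ∈ Set.Icc (-x) (t - x)
  · rw [Set.indicator_of_mem h, Set.indicator_of_mem (this.2 h), one_mul]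
  · rw [Set.indicator_of_notMem h, Set.indicator_of_notMem (fun h' => h (this.1 h')), zero_mul]

theorem fracMt_eq_setIntegral (H t x : ℝ) :
    fracMt H t x = fracC H * ∫ y in Set.Icc (-x) (t - x), |y| ^ (H - 3/2) := by
  rw [fracMt, indicator_Icc_add_mul_eq, integral_indicator measurableSet_Icc]

theorem fracMt_sub {H : ℝ} (hH : 1/2 < H) {s t : ℝ} (hs : 0 ≤ s) (hst : s ≤ t) (x : ℝ) :
    fracMt H t x - fracMt H s x = fracMt H (t - s) (x - s) := by
  have hi (a b : ℝ) : IntervalIntegrable (fun y : ℝ => |y| ^ (H - 3/2)) volume a b :=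
    ⟨(integrableOn_abs_rpow (by linarith) a b).mono_set Set.Ioc_subset_Icc_self,
      (integrableOn_abs_rpow (by linarith) b a).mono_set Set.Ioc_subset_Icc_self⟩
  simp only [fracMt_eq_setIntegral, integral_Icc_eq_integral_Ioc]
  rw [← intervalIntegral.integral_of_le (by linarith),
    ← intervalIntegral.integral_of_le (by linarith),
    ← intervalIntegral.integral_of_le (by linarith), ← mul_sub,
    intervalIntegral.integral_interval_sub_left (hi _ _) (hi _ _)]
  congr 2 <;> ring

theorem fracMt_scale (H : ℝ) {t : ℝ} (ht : 0 < t) (x : ℝ) :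
    fracMt H t x = t ^ (H - 1/2) * fracMt H 1 (x / t) := by
  have h := Measure.integral_comp_mul_left
    (fun y : ℝ => Set.indicator (Set.Icc 0 t) (fun _ => (1:ℝ)) (x + y) * |y| ^ (H - 3/2)) t
  have hg (z : ℝ) : Set.indicator (Set.Icc 0 t) (fun _ => (1:ℝ)) (x + t * z) * |t * z| ^ (H - 3/2)
      = t ^ (H - 3/2) *
        (Set.indicator (Set.Icc 0 1) (fun _ => (1:ℝ)) (x / t + z) * |z| ^ (H - 3/2)) := by
    have hmem : x + t * z ∈ Set.Icc 0 t ↔ x / t + z ∈ Set.Icc (0:ℝ) 1 := by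
      have : x + t * z = t * (x / t + z) := by field_simp
      rw [this, Set.mem_Icc, Set.mem_Icc, mul_nonneg_iff_of_pos_left ht, mul_le_iff_le_one_right ht]
    rw [abs_mul, abs_of_pos ht, mul_rpow ht.le (abs_nonneg z)]
    simp only [Set.indicator_apply, hmem]
    ring
  simp only [hg, integral_const_mul, smul_eq_mul, abs_of_pos (inv_pos.2 ht)] at h
  have ht' : t ^ (H - 1/2) = t * t ^ (H - 3/2) := by
    rw [mul_comm, ← rpow_add_one ht.ne']
    congr 1
    ring
  rw [eq_inv_mul_iff_mul_eq₀ ht.ne'] at h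
  rw [fracMt, fracMt, ← h, ht']
  ring

theorem fracMt_zero (H x : ℝ) : fracMt H 0 x = 0 := by
  simp [fracMt_eq_setIntegral]

theorem measurable_fracMt (H t : ℝ) : Measurable (fracMt H t) := by
  have hm : Measurable (Function.uncurry fun x y : ℝ =>
      Set.indicator (Set.Icc 0 t) (fun _ => (1:ℝ)) (x + y) * |y| ^ (H - 3/2)) := by
    refine Measurable.mul ?_ ?_
    · exact (measurable_const.indicator measurableSet_Icc).comp
        (measurable_fst.add measurable_snd)
    · exact (measurable_snd.abs).pow_const _
  exact (hm.stronglyMeasurable.integral_prod_right (ν := volume)).measurable.const_mul _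

theorem abs_rpow_le_of_abs_le {p : ℝ} (hp : p < 0) {x y : ℝ} (h : |x| ≤ 1 + |y|) :
    |y| ^ p ≤ (1 + |x|) ^ p * 3 ^ (-p) * (1 + Set.indicator (Set.Icc (-1) 1) (|·| ^ p) y) := by
  rcases (abs_nonneg y).eq_or_lt with hy | hy
  · rw [← hy, zero_rpow hp.ne]
    have : 0 ≤ Set.indicator (Set.Icc (-1) 1) (|·| ^ p) y :=
      Set.indicator_nonneg (fun z _ => rpow_nonneg (abs_nonneg z) p) y
    positivity
  have hx : 0 < 1 + |x| := by positivity
  have hneg (u : ℝ) (hu : 0 < u) (hxu : 1 + |x| ≤ 3 * u) : u ^ p ≤ (1 + |x|) ^ p * 3 ^ (-p) := by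
    have h₁ := rpow_le_rpow_of_nonpos hx hxu hp.le
    rw [mul_rpow (by norm_num) hu.le] at h₁
    rw [rpow_neg (by norm_num), ← div_eq_mul_inv, le_div_iff₀ (by positivity), mul_comm]
    exact h₁
  by_cases hy1 : y ∈ Set.Icc (-1 : ℝ) 1
  · rw [Set.indicator_of_mem hy1]
    have h₁ := hneg 1 one_pos (by linarith [abs_le.2 hy1])
    rw [one_rpow] at h₁
    have : 0 ≤ |y| ^ p := by positivity
    calc |y| ^ p ≤ 1 * (1 + |y| ^ p) := by linarith
      _ ≤ _ := by gcongr
  · rw [Set.indicator_of_notMem hy1, add_zero, mul_one]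
    have : 1 < |y| := by
      by_contra! h'
      exact hy1 (abs_le.1 h')
    exact hneg _ hy (by linarith)

theorem exists_abs_fracMt_one_le {H : ℝ} (hH : H ∈ Set.Ioo (1/2 : ℝ) 1) :
    ∃ C, ∀ x, |fracMt H 1 x| ≤ C * (1 + |x|) ^ (H - 3/2) := by
  obtain ⟨hH₁, hH₂⟩ := hH
  set p := H - 3/2 with hp
  have hp₁ : -1 < p := by linarith
  have hp₂ : p < 0 := by linarith
  set h : ℝ → ℝ := Set.indicator (Set.Icc (-1) 1) (|·| ^ p)
  have hh : Integrable h := (integrableOn_abs_rpow hp₁ (-1) 1).integrable_indicator measurableSet_Icc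
  have hh₀ (y : ℝ) : 0 ≤ h y := Set.indicator_nonneg (fun z _ => rpow_nonneg (abs_nonneg z) p) y
  refine ⟨|fracC H| * (3 ^ (-p) * (1 + ∫ y, h y)), fun x => ?_⟩
  have hone : IntegrableOn (fun _ : ℝ => (1:ℝ)) (Set.Icc (-x) (1 - x)) :=
    integrableOn_const (by simp)
  rw [fracMt_eq_setIntegral, abs_mul, mul_assoc]
  refine mul_le_mul_of_nonneg_left ?_ (abs_nonneg _)
  rw [abs_of_nonneg (integral_nonneg fun y => rpow_nonneg (abs_nonneg y) _)]
  calc ∫ y in Set.Icc (-x) (1 - x), |y| ^ p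
      ≤ ∫ y in Set.Icc (-x) (1 - x), (1 + |x|) ^ p * 3 ^ (-p) * (1 + h y) := by
        refine setIntegral_mono_on (integrableOn_abs_rpow hp₁ _ _)
          ((hone.add hh.integrableOn).const_mul _) measurableSet_Icc fun y hy => ?_
        refine abs_rpow_le_of_abs_le hp₂ (abs_le.2 ⟨?_, ?_⟩)
        · linarith [hy.1, le_abs_self y]
        · linarith [hy.2, neg_abs_le y]
    _ = (1 + |x|) ^ p * 3 ^ (-p) * (1 + ∫ y in Set.Icc (-x) (1 - x), h y) := by
        rw [integral_const_mul, integral_add hone hh.integrableOn]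
        simp
    _ ≤ (1 + |x|) ^ p * 3 ^ (-p) * (1 + ∫ y, h y) := by
        gcongr ?_ * (1 + ?_)
        exact setIntegral_le_integral hh (Filter.Eventually.of_forall hh₀)
    _ = _ := by ring

theorem memLp_two_fracMt {H : ℝ} (hH : H ∈ Set.Ioo (1/2 : ℝ) 1) {t : ℝ} (ht : 0 ≤ t) :
    MemLp (fracMt H t) 2 := by
  rw [memLp_two_iff_integrable_sq (measurable_fracMt H t).aestronglyMeasurable]
  rcases ht.eq_or_lt with rfl | ht
  · simp [fracMt_zero]
  have hone : Integrable fun x => fracMt H 1 x ^ 2 := by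
    obtain ⟨C, hC⟩ := exists_abs_fracMt_one_le hH
    have hint : Integrable fun x : ℝ => (1 + ‖x‖) ^ (-(3 - 2 * H)) :=
      integrable_one_add_norm (by simp; linarith [hH.2])
    refine (hint.const_mul (C ^ 2)).mono'
      ((measurable_fracMt H 1).pow_const 2).aestronglyMeasurable
      (Filter.Eventually.of_forall fun x => ?_)
    have hx : (0:ℝ) ≤ 1 + |x| := by positivity
    have hsq : (1 + |x|) ^ (-(3 - 2 * H)) = ((1 + |x|) ^ (H - 3/2)) ^ 2 := by
      rw [← rpow_mul_natCast hx]
      congr 1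
      push_cast
      ring
    rw [norm_pow, norm_eq_abs, norm_eq_abs, hsq, ← mul_pow]
    exact pow_le_pow_left₀ (abs_nonneg _) (hC x) 2
  simp only [fracMt_scale H ht, mul_pow]
  exact (hone.comp_div ht.ne').const_mul _

theorem integral_fracMt_sq {H : ℝ} (hH : 0 < H) {t : ℝ} (ht : 0 ≤ t) :
    ∫ x, fracMt H t x ^ 2 = t ^ (2 * H) * ∫ x, fracMt H 1 x ^ 2 := by
  rcases ht.eq_or_lt with rfl | ht
  · simp [fracMt_zero, hH.ne']
  simp only [fracMt_scale H ht, mul_pow, integral_const_mul]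
  rw [Measure.integral_comp_div (fun x => fracMt H 1 x ^ 2) t, smul_eq_mul, abs_of_pos ht,
    ← mul_assoc, ← rpow_mul_natCast ht.le, ← rpow_add_one ht.ne']
  congr 2
  push_cast
  ring

/-- Covariance identity: for `H ∈ (1/2,1)`, `K_H = ∫_ℝ M_1(x)² dx` and `0 ≤ s ≤ t`,
`∫_ℝ M_s(x) M_t(x) dx = (K_H/2)(s^{2H} + t^{2H} − (t−s)^{2H})`. -/
theorem fracMt_inner_product (H : ℝ) (hH : H ∈ Set.Ioo (1/2 : ℝ) 1)
    (s t : ℝ) (hs : 0 ≤ s) (hst : s ≤ t) :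
    ∫ x : ℝ, fracMt H s x * fracMt H t x
      = (∫ x : ℝ, (fracMt H 1 x)^2) / 2 * (s ^ (2*H) + t ^ (2*H) - (t - s) ^ (2*H)) := by
  have hH₀ : 0 < H := by linarith [hH.1]
  have ht : 0 ≤ t := hs.trans hst
  have hms := memLp_two_fracMt hH hs
  have hmt := memLp_two_fracMt hH ht
  have hdiff : ∫ x, (fracMt H t x - fracMt H s x) ^ 2
      = (t - s) ^ (2 * H) * ∫ x, fracMt H 1 x ^ 2 := by
    simp only [fracMt_sub hH.1 hs hst]
    rw [integral_sub_right_eq_self (fun x => fracMt H (t - s) x ^ 2) s,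
      integral_fracMt_sq hH₀ (sub_nonneg.2 hst)]
  have hpol (x : ℝ) : fracMt H s x * fracMt H t x
      = (fracMt H s x ^ 2 + fracMt H t x ^ 2 - (fracMt H t x - fracMt H s x) ^ 2) / 2 := by
    ring
  have hsub : Integrable fun x => (fracMt H t x - fracMt H s x) ^ 2 := (hmt.sub hms).integrable_sq
  have hadd : Integrable fun x => fracMt H s x ^ 2 + fracMt H t x ^ 2 :=
    hms.integrable_sq.add hmt.integrable_sq
  simp only [hpol]
  rw [integral_div, integral_sub hadd hsub,
    integral_add hms.integrable_sq hmt.integrable_sq, hdiff, integral_fracMt_sq hH₀ hs,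
    integral_fracMt_sq hH₀ ht]
  ring
end
end

section
/- Let H ∈ (1/2,1) and for t > 0 define I(t) = ∫_ℝ ∫_ℝ |yz|^{H−3/2} χ_{[0,t]}(y+z+t) dy dz (a Lebesgue integral in [0,∞]). Then 0 < I(1) < ∞, and I(t) = t^{2H−1} I(1) for every t > 0. -/
open MeasureTheory Real
open scoped ENNReal

noncomputable section

/-- `I(t) = ∫_ℝ ∫_ℝ |yz|^{H−3/2} χ_{[0,t]}(y+z+t) dy dz`, a Lebesgue integral in `[0,∞]`
(up to the constant `C_H²`, the diffusion coefficient in the Fokker–Planck equation for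
the law of fractional Brownian motion). -/
noncomputable def fbmDiffusionIntegral (H t : ℝ) : ℝ≥0∞ :=
  ∫⁻ y : ℝ, ∫⁻ z : ℝ, ENNReal.ofReal (|y * z| ^ (H - 3/2)) *
    Set.indicator (Set.Icc 0 t) (fun _ => (1 : ℝ≥0∞)) (y + z + t)

theorem lintegral_comp_abs (f : ℝ → ℝ≥0∞) :
    ∫⁻ x : ℝ, f |x| = 2 * ∫⁻ x in Set.Ioi 0, f x := by
  have hpos : ∫⁻ x in Set.Ioi (0 : ℝ), f |x| = ∫⁻ x in Set.Ioi 0, f x :=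
    setLIntegral_congr_fun measurableSet_Ioi fun x hx => by
      simp only [abs_of_pos (Set.mem_Ioi.mp hx)]
  have hneg : ∫⁻ x in Set.Iio (0 : ℝ), f |x| = ∫⁻ x in Set.Ioi (0 : ℝ), f |x| := by
    have h := (Measure.measurePreserving_neg (volume : Measure ℝ)).setLIntegral_comp_preimage_emb
      (MeasurableEquiv.neg ℝ).measurableEmbedding (fun x => f |x|) (Set.Ioi 0)
    simpa using h
  rw [← lintegral_add_compl _ (measurableSet_Ioi (a := (0 : ℝ))), Set.compl_Ioi,
    setLIntegral_congr Iio_ae_eq_Iic.symm, hneg, hpos, two_mul]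

theorem lintegral_comp_mul_left (f : ℝ → ℝ≥0∞) {t : ℝ} (ht : 0 < t) :
    ∫⁻ x : ℝ, f x = ENNReal.ofReal t * ∫⁻ x : ℝ, f (t * x) := by
  have h := congrArg (fun μ : Measure ℝ => ∫⁻ x, f x ∂μ) (smul_map_volume_mul_left ht.ne')
  simp only [lintegral_smul_measure, smul_eq_mul, abs_of_pos ht] at h
  rw [← h]
  exact congrArg _
    ((Homeomorph.mulLeft₀ t ht.ne').measurableEmbedding.lintegral_map (μ := volume) f)

theorem lintegral_indicator_Iic_rpow_abs_lt_top {a c : ℝ} (ha : -1 < a) (hc : 0 < c) :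
    ∫⁻ x : ℝ, (Set.Iic c).indicator (fun r => ENNReal.ofReal (r ^ a)) |x| < ⊤ := by
  rw [lintegral_comp_abs, setLIntegral_indicator measurableSet_Iic, Set.inter_comm,
    Set.Ioi_inter_Iic]
  exact ENNReal.mul_lt_top (by simp) ((intervalIntegrable_iff_integrableOn_Ioc_of_le hc.le).1
    (intervalIntegral.intervalIntegrable_rpow' ha)).setLIntegral_lt_top

theorem lintegral_indicator_Ioi_rpow_abs_lt_top {a c : ℝ} (ha : a < -1) (hc : 0 < c) :
    ∫⁻ x : ℝ, (Set.Ioi c).indicator (fun r => ENNReal.ofReal (r ^ a)) |x| < ⊤ := by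
  rw [lintegral_comp_abs, setLIntegral_indicator measurableSet_Ioi,
    Set.inter_eq_left.2 (Set.Ioi_subset_Ioi hc.le)]
  exact ENNReal.mul_lt_top (by simp) (integrableOn_Ioi_rpow_of_lt ha hc).setLIntegral_lt_top

theorem lintegral_indicator_Icc_shift (y : ℝ) :
    ∫⁻ z : ℝ, (Set.Icc 0 1).indicator (fun _ => (1 : ℝ≥0∞)) (y + z + 1) = 1 := by
  calc _ = ∫⁻ z : ℝ, (Set.Icc (0 : ℝ) 1).indicator (fun _ => (1 : ℝ≥0∞)) (z + (y + 1)) := by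
        congr! 3 with z
        ring
    _ = _ := by
        rw [lintegral_add_right_eq_self
          (fun z => (Set.Icc (0 : ℝ) 1).indicator (fun _ => (1 : ℝ≥0∞)) z) (y + 1),
          lintegral_indicator measurableSet_Icc]
        simp

/-- The mass of `|z|^a dz` on the interval `[-1-y, -y]`. -/
def powerMass (a y : ℝ) : ℝ≥0∞ :=
  ∫⁻ z : ℝ, ENNReal.ofReal (|z| ^ a) *
    (Set.Icc 0 1).indicator (fun _ => (1 : ℝ≥0∞)) (y + z + 1)

theorem powerMass_le {a : ℝ} (ha : a < 0) (y : ℝ) :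
    powerMass a y ≤
      (∫⁻ z : ℝ, (Set.Iic 1).indicator (fun r => ENNReal.ofReal (r ^ a)) |z|) + 1 := by
  rw [← lintegral_indicator_Icc_shift y, ← lintegral_add_right]
  · refine lintegral_mono fun z => ?_
    by_cases hz : |z| ≤ 1
    · rw [Set.indicator_of_mem (Set.mem_Iic.2 hz)]
      refine le_add_right (mul_le_of_le_one_right' ?_)
      exact Set.indicator_le_self' (fun _ _ => zero_le) _
    · refine le_add_left (mul_le_of_le_one_left' ?_)
      exact ENNReal.ofReal_le_one.2 (rpow_le_one_of_one_le_of_nonpos (not_le.1 hz).le ha.le)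
  · exact (measurable_const.indicator measurableSet_Icc).comp (by fun_prop)

theorem powerMass_le_of_two_lt_abs {a y : ℝ} (ha : a < 0) (hy : 2 < |y|) :
    powerMass a y ≤ ENNReal.ofReal ((|y| / 2) ^ a) := by
  rw [← mul_one (ENNReal.ofReal _), ← lintegral_indicator_Icc_shift y,
    ← lintegral_const_mul' _ _ ENNReal.ofReal_ne_top]
  refine lintegral_mono fun z => ?_
  by_cases hz : y + z + 1 ∈ Set.Icc (0 : ℝ) 1
  · refine mul_le_mul_left ?_ _
    refine ENNReal.ofReal_le_ofReal (rpow_le_rpow_of_nonpos (by linarith) ?_ ha.le)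
    obtain ⟨h0, h1⟩ := hz
    rcases abs_cases y with h | h <;> rcases abs_cases z with h' | h' <;> linarith
  · simp [Set.indicator_of_notMem hz]

theorem fbmDiffusionIntegral_one_eq (H : ℝ) :
    fbmDiffusionIntegral H 1 =
      ∫⁻ y : ℝ, ENNReal.ofReal (|y| ^ (H - 3/2)) * powerMass (H - 3/2) y := by
  refine lintegral_congr fun y => ?_
  rw [powerMass, ← lintegral_const_mul' _ _ ENNReal.ofReal_ne_top]
  refine lintegral_congr fun z => ?_
  rw [abs_mul, mul_rpow (abs_nonneg _) (abs_nonneg _), ENNReal.ofReal_mul (by positivity),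
    mul_assoc]

theorem fbmDiffusionIntegral_one_lt_top {H : ℝ} (hH : H ∈ Set.Ioo (1/2 : ℝ) 1) :
    fbmDiffusionIntegral H 1 < ⊤ := by
  obtain ⟨hH₁, hH₂⟩ := hH
  rw [fbmDiffusionIntegral_one_eq]
  set a := H - 3/2 with ha
  have ha₀ : a < 0 := by linarith
  set C := (∫⁻ z : ℝ, (Set.Iic 1).indicator (fun r => ENNReal.ofReal (r ^ a)) |z|) + 1
  have hC : C < ⊤ := ENNReal.add_lt_top.2
    ⟨lintegral_indicator_Iic_rpow_abs_lt_top (by linarith) one_pos, ENNReal.one_lt_top⟩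
  calc ∫⁻ y : ℝ, ENNReal.ofReal (|y| ^ a) * powerMass a y
      ≤ ∫⁻ y : ℝ, (C * (Set.Iic 2).indicator (fun r => ENNReal.ofReal (r ^ a)) |y| +
          ENNReal.ofReal ((2⁻¹ : ℝ) ^ a) *
            (Set.Ioi 2).indicator (fun r => ENNReal.ofReal (r ^ (2 * a))) |y|) := by
        refine lintegral_mono fun y => ?_
        rcases le_or_gt |y| 2 with hy | hy
        · rw [Set.indicator_of_mem (Set.mem_Iic.2 hy), mul_comm C]
          exact le_add_right (mul_le_mul_right (powerMass_le ha₀ y) _)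
        · rw [Set.indicator_of_mem (Set.mem_Ioi.2 hy)]
          refine le_add_left ((mul_le_mul_right (powerMass_le_of_two_lt_abs ha₀ hy) _).trans_eq ?_)
          have hy₀ : 0 < |y| := by linarith
          rw [← ENNReal.ofReal_mul (by positivity), ← ENNReal.ofReal_mul (by positivity),
            div_eq_inv_mul, mul_rpow (by positivity) hy₀.le, two_mul, rpow_add hy₀]
          congr 1
          ring
    _ = C * (∫⁻ y : ℝ, (Set.Iic 2).indicator (fun r => ENNReal.ofReal (r ^ a)) |y|) +
          ENNReal.ofReal ((2⁻¹ : ℝ) ^ a) *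
            ∫⁻ y : ℝ, (Set.Ioi 2).indicator (fun r => ENNReal.ofReal (r ^ (2 * a))) |y| := by
        have hmeas : Measurable fun y : ℝ =>
            (Set.Iic 2).indicator (fun r => ENNReal.ofReal (r ^ a)) |y| :=
          (Measurable.indicator (by fun_prop) measurableSet_Iic).comp (by fun_prop)
        rw [lintegral_add_left (hmeas.const_mul C), lintegral_const_mul' _ _ hC.ne,
          lintegral_const_mul' _ _ ENNReal.ofReal_ne_top]
    _ < ⊤ := ENNReal.add_lt_top.2
        ⟨ENNReal.mul_lt_top hC (lintegral_indicator_Iic_rpow_abs_lt_top (by linarith) two_pos),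
          ENNReal.mul_lt_top ENNReal.ofReal_lt_top
            (lintegral_indicator_Ioi_rpow_abs_lt_top (by linarith) two_pos)⟩

theorem fbmDiffusionIntegral_one_pos {H : ℝ} (hH : H ≤ 3/2) :
    0 < fbmDiffusionIntegral H 1 := by
  let s : Set ℝ := Set.Ioo (-1/2) 0
  have hs : volume s ≠ 0 := by norm_num [s]
  have hle : ∫⁻ _ in s, ∫⁻ _ in s, (1 : ℝ≥0∞) ≤ fbmDiffusionIntegral H 1 := by
    refine (setLIntegral_mono' measurableSet_Ioo fun y hy => ?_).trans
      (setLIntegral_le_lintegral s _)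
    refine (setLIntegral_mono' measurableSet_Ioo fun z hz => ?_).trans
      (setLIntegral_le_lintegral s _)
    obtain ⟨hy₁, hy₂⟩ := hy
    obtain ⟨hz₁, hz₂⟩ := hz
    have hyz : 0 < y * z := mul_pos_of_neg_of_neg hy₂ hz₂
    have hmem : y + z + 1 ∈ Set.Icc (0 : ℝ) 1 := ⟨by linarith, by linarith⟩
    rw [Set.indicator_of_mem hmem, mul_one, ENNReal.one_le_ofReal,
      abs_of_pos hyz]
    exact one_le_rpow_of_pos_of_le_one_of_nonpos hyz (by nlinarith) (by linarith)
  refine lt_of_lt_of_le (pos_iff_ne_zero.2 ?_) hle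
  simpa using hs

theorem fbmDiffusionIntegral_eq_mul (H : ℝ) {t : ℝ} (ht : 0 < t) :
    fbmDiffusionIntegral H t
      = ENNReal.ofReal (t ^ (2*H - 1)) * fbmDiffusionIntegral H 1 := by
  have hpow : t ^ (2*H - 1) = t * (t * (t * t) ^ (H - 3/2)) := by
    rw [mul_rpow ht.le ht.le, show 2*H - 1 = 1 + (1 + ((H - 3/2) + (H - 3/2))) by ring,
      rpow_add ht, rpow_add ht, rpow_add ht, rpow_one]
  rw [fbmDiffusionIntegral, lintegral_comp_mul_left _ ht, hpow, ENNReal.ofReal_mul ht.le, mul_assoc,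
    fbmDiffusionIntegral, ← lintegral_const_mul' (ENNReal.ofReal (t * _)) _ ENNReal.ofReal_ne_top]
  congr 1
  refine lintegral_congr fun y => ?_
  rw [lintegral_comp_mul_left _ ht, ENNReal.ofReal_mul ht.le, mul_assoc,
    ← lintegral_const_mul' (ENNReal.ofReal ((t * t) ^ _)) _ ENNReal.ofReal_ne_top]
  congr 1
  refine lintegral_congr fun z => ?_
  have habs : |t * y * (t * z)| ^ (H - 3/2) = (t * t) ^ (H - 3/2) * |y * z| ^ (H - 3/2) := by
    rw [← mul_rpow (by positivity) (abs_nonneg _), ← abs_of_pos (mul_pos ht ht), ← abs_mul]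
    congr 2
    ring
  have hmem : t * y + t * z + t ∈ Set.Icc 0 t ↔ y + z + 1 ∈ Set.Icc (0 : ℝ) 1 := by
    rw [show t * y + t * z + t = t * (y + z + 1) by ring, Set.mem_Icc, Set.mem_Icc,
      mul_nonneg_iff_of_pos_left ht, mul_le_iff_le_one_right ht]
  rw [habs, ENNReal.ofReal_mul (by positivity), mul_assoc]
  simp only [Set.indicator_apply, hmem]

/-- For `H ∈ (1/2,1)`: `0 < I(1) < ∞`, and `I(t) = t^{2H−1} I(1)` for every `t > 0`. -/
theorem fbmDiffusionIntegral_scaling (H : ℝ) (hH : H ∈ Set.Ioo (1/2 : ℝ) 1) :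
    0 < fbmDiffusionIntegral H 1 ∧ fbmDiffusionIntegral H 1 < ⊤ ∧
    ∀ t : ℝ, 0 < t →
      fbmDiffusionIntegral H t
        = ENNReal.ofReal (t ^ (2*H - 1)) * fbmDiffusionIntegral H 1 := by
  exact ⟨fbmDiffusionIntegral_one_pos (by linarith [hH.2]), fbmDiffusionIntegral_one_lt_top hH,
    fun _ ht => fbmDiffusionIntegral_eq_mul H ht⟩
end
end

section
/- Let T > 0, let a : [0,T] × ℝ → ℝ be bounded and continuous, let b : [0,T] → ℝ be continuous, and let (μ_t)_{t∈[0,T]} be a family of Borel probability measures on ℝ such that t ↦ μ_t is continuous for the topology of weak convergence. For y ∈ ℝ set μ̂_t(y) = ∫_ℝ e^{−ixy} μ_t(dx) and L_s(y) = ∫_ℝ ( −i y a(s,x) − (1/2) y² b(s) ) e^{−iyx} μ_s(dx). Assume that for all 0 ≤ t ≤ t' ≤ T and all y ∈ ℝ, μ̂_{t'}(y) − μ̂_t(y) = ∫_t^{t'} L_s(y) ds. Then for every Schwartz function φ ∈ 𝒮(ℝ), the map t ↦ ∫_ℝ φ dμ_t is differentiable on (0,T) with d/dt ∫_ℝ φ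 dμ_t = ∫_ℝ [ a(t,x) φ'(x) + (1/2) b(t) φ''(x) ] μ_t(dx). -/
open MeasureTheory Real Filter

noncomputable section

open scoped FourierTransform LineDeriv SchwartzMap BoundedContinuousFunction

/-- The integral of a jointly continuous bounded function against a weakly continuous family of
probability measures depends continuously on the parameter. -/
theorem continuous_integral_of_weaklyContinuous {𝕜 X Ω : Type*} [RCLike 𝕜]
    [TopologicalSpace X] [SecondCountableTopology X] [TopologicalSpace.PseudoMetrizableSpace X]
    [MeasurableSpace X] [BorelSpace X]
    [TopologicalSpace Ω] [SecondCountableTopology Ω] [TopologicalSpace.PseudoMetrizableSpace Ω]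
    [MeasurableSpace Ω] [BorelSpace Ω]
    {μ : X → ProbabilityMeasure Ω} (hμ : Continuous μ) {F : X → Ω → 𝕜}
    (hF : Continuous (Function.uncurry F)) {C : ℝ} (hC : ∀ x ω, ‖F x ω‖ ≤ C) :
    Continuous fun x ↦ ∫ ω, F x ω ∂(μ x : Measure Ω) := by
  let f : X × Ω →ᵇ 𝕜 :=
    BoundedContinuousFunction.ofNormedAddCommGroup (Function.uncurry F) hF C fun p ↦ hC p.1 p.2
  have hν : Continuous fun x ↦ (diracProba x).prod (μ x) :=
    ProbabilityMeasure.continuous_prod.comp (continuous_diracProba.prodMk hμ)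
  have key : ∀ x, ∫ p, f p ∂((diracProba x).prod (μ x) : Measure (X × Ω))
      = ∫ ω, F x ω ∂(μ x : Measure Ω) := by
    intro x
    change ∫ p, f p ∂((Measure.dirac x).prod (μ x : Measure Ω)) = _
    rw [Measure.dirac_prod, integral_map (by fun_prop) (by fun_prop)]
    rfl
  rw [continuous_iff_continuousAt] at hν ⊢
  intro x
  have h := (ProbabilityMeasure.tendsto_iff_forall_integral_rclike_tendsto 𝕜).1 (hν x) f
  simpa only [ContinuousAt, key] using h

/-- The character `x ↦ e^{-i (2π y) x}`, in the normalisation of Mathlib's Fourier transform. -/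
def fourierExp (y x : ℝ) : ℂ :=
  Complex.exp (-(Complex.I * ((2 * π * y : ℝ) : ℂ) * (x : ℂ)))

theorem norm_fourierExp (y x : ℝ) : ‖fourierExp y x‖ = 1 := by
  rw [fourierExp, show -(Complex.I * ((2 * π * y : ℝ) : ℂ) * (x : ℂ))
    = ((-(2 * π * y * x) : ℝ) : ℂ) * Complex.I by push_cast; ring]
  exact Complex.norm_exp_ofReal_mul_I _

theorem continuous_fourierExp : Continuous (Function.uncurry fourierExp) := by
  unfold fourierExp Function.uncurry
  fun_prop

/-- Pairing a Schwartz function with a finite complex measure `g ν`, on the Fourier side. -/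
theorem integral_schwartz_mul (Φ : 𝓢(ℝ, ℂ)) {ν : Measure ℝ} [SigmaFinite ν] {g : ℝ → ℂ}
    (hg : Integrable g ν) :
    ∫ x, Φ x * g x ∂ν = ∫ y, (𝓕⁻ Φ) y * ∫ x, fourierExp y x * g x ∂ν := by
  have h := VectorFourier.integral_fourierIntegral_smul_eq_flip (μ := volume) (ν := ν)
    (L := LinearMap.mul ℝ ℝ) (f := (𝓕⁻ Φ : 𝓢(ℝ, ℂ))) (g := g) Real.continuous_fourierChar
    (by simpa using continuous_mul) (𝓕⁻ Φ).integrable hg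
  have h1 : ∀ x, VectorFourier.fourierIntegral 𝐞 volume (LinearMap.mul ℝ ℝ)
      (𝓕⁻ Φ : 𝓢(ℝ, ℂ)) x = Φ x := by
    intro x
    have : 𝓕 (𝓕⁻ Φ) = Φ := FourierTransform.fourier_fourierInv_eq Φ
    conv_rhs => rw [← this, SchwartzMap.fourier_coe, Real.fourier_real_eq]
    rfl
  simp only [h1, smul_eq_mul] at h
  rw [h]
  refine integral_congr_ae (.of_forall fun y ↦ ?_)
  simp only [VectorFourier.fourierIntegral]
  congr 1
  refine integral_congr_ae (.of_forall fun x ↦ ?_)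
  simp only [Circle.smul_def, smul_eq_mul, Real.fourierChar_apply, fourierExp]
  congr 2
  simp
  ring

theorem fourierInv_derivCLM (Φ : 𝓢(ℝ, ℂ)) (y : ℝ) :
    𝓕⁻ (SchwartzMap.derivCLM ℂ ℂ Φ) y = -(Complex.I * ((2 * π * y : ℝ) : ℂ)) * 𝓕⁻ Φ y := by
  have h : SchwartzMap.derivCLM ℂ ℂ Φ = ∂_{(1 : ℝ)} Φ := by
    ext x
    simp [SchwartzMap.lineDerivOp_apply_eq_fderiv]
  have ht : (inner ℝ · (1 : ℝ)).HasTemperateGrowth := by fun_prop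
  rw [h, SchwartzMap.fourierInv_lineDerivOp_eq]
  have hsmul := SchwartzMap.smulLeftCLM_apply_apply ht (𝓕⁻ Φ) y
  rw [smul_apply, hsmul]
  simp
  ring

/-- The integrated Fokker–Planck equation on the characteristic functions implies the integrated
weak equation for Schwartz functions. -/
theorem integral_schwartz_sub_eq (a : ℝ → ℝ → ℝ) (b : ℝ → ℝ) (μ : ℝ → ProbabilityMeasure ℝ)
    (ha : Continuous (Function.uncurry a)) {C : ℝ} (hC : ∀ s x, |a s x| ≤ C)
    (hb : Continuous b) {B : ℝ} (hB : ∀ s, |b s| ≤ B) (hμ : Continuous μ) {t t' : ℝ}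
    (hchar : ∀ y : ℝ,
      (∫ x : ℝ, Complex.exp (-(Complex.I * (y:ℂ) * (x:ℂ))) ∂(μ t' : Measure ℝ))
        - (∫ x : ℝ, Complex.exp (-(Complex.I * (y:ℂ) * (x:ℂ))) ∂(μ t : Measure ℝ))
        = ∫ s in t..t',
            ∫ x : ℝ, (-(Complex.I * (y:ℂ) * (a s x : ℂ))
                - (1/2 : ℂ) * (y:ℂ)^2 * (b s : ℂ))
              * Complex.exp (-(Complex.I * (y:ℂ) * (x:ℂ))) ∂(μ s : Measure ℝ))
    (Φ : 𝓢(ℝ, ℂ)) :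
    ∫ x, Φ x ∂(μ t' : Measure ℝ) - ∫ x, Φ x ∂(μ t : Measure ℝ)
      = ∫ s in t..t', ∫ x, ((a s x : ℂ) * deriv Φ x + (1/2) * (b s : ℂ) * deriv (deriv Φ) x)
          ∂(μ s : Measure ℝ) := by
  set Φ₁ := SchwartzMap.derivCLM ℂ ℂ Φ with hΦ₁
  set Φ₂ := SchwartzMap.derivCLM ℂ ℂ Φ₁ with hΦ₂
  have hd₁ : deriv Φ = Φ₁ := rfl
  have hd₂ : deriv Φ₁ = Φ₂ := rfl
  let A : ℝ → ℝ → ℂ := fun s y ↦ ∫ x, fourierExp y x * (a s x : ℂ) ∂(μ s : Measure ℝ)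
  let M : ℝ → ℝ → ℂ := fun s y ↦ ∫ x, fourierExp y x ∂(μ s : Measure ℝ)
  have hexp (y : ℝ) : Continuous (fourierExp y) :=
    continuous_fourierExp.comp (Continuous.prodMk_right y)
  have hEa (s y : ℝ) (x : ℝ) : ‖fourierExp y x * (a s x : ℂ)‖ ≤ C := by
    simpa [norm_fourierExp] using hC s x
  have hA : Continuous (Function.uncurry A) := by
    refine continuous_integral_of_weaklyContinuous (μ := fun p : ℝ × ℝ ↦ μ p.1)
      (F := fun p x ↦ fourierExp p.2 x * (a p.1 x : ℂ)) (by fun_prop) ?_ (fun p x ↦ hEa _ _ _)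
    have h1 : Continuous fun q : (ℝ × ℝ) × ℝ ↦ fourierExp q.1.2 q.2 :=
      continuous_fourierExp.comp (by fun_prop : Continuous fun q : (ℝ × ℝ) × ℝ ↦ (q.1.2, q.2))
    have h2 : Continuous fun q : (ℝ × ℝ) × ℝ ↦ a q.1.1 q.2 :=
      ha.comp (by fun_prop : Continuous fun q : (ℝ × ℝ) × ℝ ↦ (q.1.1, q.2))
    exact h1.mul (Complex.continuous_ofReal.comp h2)
  have hM : Continuous (Function.uncurry M) := by
    refine continuous_integral_of_weaklyContinuous (μ := fun p : ℝ × ℝ ↦ μ p.1)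
      (F := fun p x ↦ fourierExp p.2 x) (by fun_prop) ?_ (fun p x ↦ (norm_fourierExp _ _).le)
    exact continuous_fourierExp.comp
      (by fun_prop : Continuous fun q : (ℝ × ℝ) × ℝ ↦ (q.1.2, q.2))
  have hA_le (s y : ℝ) : ‖A s y‖ ≤ C := by
    simpa using norm_integral_le_of_norm_le_const (μ := (μ s : Measure ℝ)) (.of_forall (hEa s y))
  have hM_le (s y : ℝ) : ‖M s y‖ ≤ 1 := by
    simpa using norm_integral_le_of_norm_le_const (μ := (μ s : Measure ℝ))
      (.of_forall fun x ↦ (norm_fourierExp y x).le)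
  have hMb_le (s y : ℝ) : ‖(b s : ℂ) * M s y‖ ≤ B := by
    rw [norm_mul, Complex.norm_real]
    calc |b s| * ‖M s y‖ ≤ |b s| * 1 := by gcongr; exact hM_le s y
      _ ≤ B := by simpa using hB s
  have ha_meas (s : ℝ) : Continuous fun x ↦ (a s x : ℂ) :=
    Complex.continuous_ofReal.comp (ha.comp (Continuous.prodMk_right s))
  have ha_int (s : ℝ) : Integrable (fun x ↦ (a s x : ℂ)) (μ s : Measure ℝ) :=
    .of_bound (ha_meas s).aestronglyMeasurable C (.of_forall fun x ↦ by simpa using hC s x)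
  have hexp_int (s y : ℝ) : Integrable (fourierExp y) (μ s : Measure ℝ) :=
    .of_bound (hexp y).aestronglyMeasurable 1 (.of_forall fun x ↦ (norm_fourierExp y x).le)
  have hEa_int (s y : ℝ) :
      Integrable (fun x ↦ fourierExp y x * (a s x : ℂ)) (μ s : Measure ℝ) :=
    .of_bound ((hexp y).mul (ha_meas s)).aestronglyMeasurable C (.of_forall (hEa s y))
  -- the Fourier side of the equation, before and after integration against `𝓕⁻ Φ`
  have hchar' (y : ℝ) : 𝓕⁻ Φ y * M t' y - 𝓕⁻ Φ y * M t y
      = ∫ s in t..t', (𝓕⁻ Φ₁ y * A s y + (1/2) * (𝓕⁻ Φ₂ y * ((b s : ℂ) * M s y))) := by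
    rw [← mul_sub]
    refine (congrArg (𝓕⁻ Φ y * ·) (hchar (2 * π * y))).trans ?_
    rw [← intervalIntegral.integral_const_mul]
    refine intervalIntegral.integral_congr fun s _ ↦ ?_
    have : ∫ x, (-(Complex.I * ((2 * π * y : ℝ):ℂ) * (a s x : ℂ))
          - (1/2 : ℂ) * ((2 * π * y : ℝ):ℂ)^2 * (b s : ℂ)) * fourierExp y x ∂(μ s : Measure ℝ)
        = -(Complex.I * ((2 * π * y : ℝ):ℂ)) * A s y
          - (1/2 : ℂ) * ((2 * π * y : ℝ):ℂ)^2 * (b s : ℂ) * M s y := by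
      simp only [A, M]
      rw [← integral_const_mul, ← integral_const_mul, ← integral_sub
        ((hEa_int s y).const_mul _) ((hexp_int s y).const_mul _)]
      refine integral_congr_ae (.of_forall fun x ↦ ?_)
      ring
    refine (congrArg (𝓕⁻ Φ y * ·) this).trans ?_
    simp only [hΦ₂, fourierInv_derivCLM, hΦ₁]
    linear_combination (-(1/2) * ((2 * π * y : ℝ):ℂ)^2 * b s * M s y * 𝓕⁻ Φ y) * Complex.I_sq
  have hint (Ψ : 𝓢(ℝ, ℂ)) {N : ℝ → ℝ → ℂ} {K : ℝ} (hN : Continuous (Function.uncurry N))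
      (hK : ∀ s y, ‖N s y‖ ≤ K) : Integrable (Function.uncurry fun s y ↦ 𝓕⁻ Ψ y * N s y)
        ((volume.restrict (Set.uIoc t t')).prod volume) := by
    have : IsFiniteMeasure (volume.restrict (Set.uIoc t t')) :=
      ⟨by simp [Set.uIoc]⟩
    exact ((𝓕⁻ Ψ).integrable (μ := volume).comp_snd _).mul_bdd hN.aestronglyMeasurable
      (.of_forall fun p ↦ hK p.1 p.2)
  have hslice (Ψ : 𝓢(ℝ, ℂ)) {N : ℝ → ℝ → ℂ} {K : ℝ} (hN : Continuous (Function.uncurry N))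
      (hK : ∀ s y, ‖N s y‖ ≤ K) (s : ℝ) : Integrable fun y ↦ 𝓕⁻ Ψ y * N s y :=
    ((𝓕⁻ Ψ).integrable (μ := volume)).mul_bdd
      (hN.comp (Continuous.prodMk_right s)).aestronglyMeasurable (.of_forall fun y ↦ hK s y)
  have hMb : Continuous (Function.uncurry fun s y ↦ (b s : ℂ) * M s y) :=
    (Complex.continuous_ofReal.comp (hb.comp continuous_fst)).mul hM
  have hΦM (Ψ : 𝓢(ℝ, ℂ)) (s : ℝ) : ∫ x, Ψ x ∂(μ s : Measure ℝ) = ∫ y, 𝓕⁻ Ψ y * M s y := by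
    simpa [M] using integral_schwartz_mul Ψ (integrable_const (μ := (μ s : Measure ℝ)) (1 : ℂ))
  have hΨ_int (Ψ : 𝓢(ℝ, ℂ)) (s : ℝ) : Integrable Ψ (μ s : Measure ℝ) :=
    Ψ.toBoundedContinuousFunction.integrable _
  rw [hΦM, hΦM, ← integral_sub (hslice Φ hM hM_le _) (hslice Φ hM hM_le _)]
  simp_rw [hchar']
  rw [← intervalIntegral_integral_swap
    ((hint Φ₁ hA hA_le).add ((hint Φ₂ hMb hMb_le).const_mul (1/2)))]
  refine intervalIntegral.integral_congr fun s _ ↦ ?_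
  rw [hd₁, hd₂, integral_add (hslice Φ₁ hA hA_le s) ((hslice Φ₂ hMb hMb_le s).const_mul _),
    integral_add, integral_const_mul, integral_const_mul, hΦM, ← integral_schwartz_mul Φ₁ (ha_int s)]
  · congr 1
    · simp only [mul_comm]
    · rw [mul_assoc, ← integral_const_mul (b s : ℂ)]
      congr 1
      refine integral_congr_ae (.of_forall fun y ↦ ?_)
      ring
  · exact ((hΨ_int Φ₁ s).bdd_mul (ha_meas s).aestronglyMeasurable
      (.of_forall fun x ↦ by simpa using hC s x))
  · exact (hΨ_int Φ₂ s).const_mul _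

/-- **Fokker–Planck equation I (weak form).** Let `T > 0`, `a : [0,T] × ℝ → ℝ` bounded and
continuous, `b : [0,T] → ℝ` continuous, and `(μ_t)` a weakly continuous family of Borel
probability measures on `ℝ`. Set `μ̂_t(y) = ∫ e^{−ixy} μ_t(dx)` and
`L_s(y) = ∫ (−iya(s,x) − (1/2)y²b(s)) e^{−iyx} μ_s(dx)`, and assume
`μ̂_{t'}(y) − μ̂_t(y) = ∫_t^{t'} L_s(y) ds` for all `0 ≤ t ≤ t' ≤ T`, `y ∈ ℝ`. Then for every
Schwartz `φ`, `t ↦ ∫ φ dμ_t` is differentiable on `(0,T)` with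
`d/dt ∫ φ dμ_t = ∫ [a(t,x)φ'(x) + (1/2)b(t)φ''(x)] μ_t(dx)`. -/
theorem fokkerPlanck_weak
    (T : ℝ) (hT : 0 < T) (a : ℝ → ℝ → ℝ) (b : ℝ → ℝ)
    (ha_cont : ContinuousOn (fun p : ℝ × ℝ => a p.1 p.2) (Set.Icc 0 T ×ˢ Set.univ))
    (ha_bdd : ∃ C : ℝ, ∀ t ∈ Set.Icc (0:ℝ) T, ∀ x : ℝ, |a t x| ≤ C)
    (hb : ContinuousOn b (Set.Icc 0 T))
    (μ : ℝ → ProbabilityMeasure ℝ)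
    (hμ_cont : ContinuousOn μ (Set.Icc 0 T))
    (hchar : ∀ t t' : ℝ, 0 ≤ t → t ≤ t' → t' ≤ T → ∀ y : ℝ,
      (∫ x : ℝ, Complex.exp (-(Complex.I * (y:ℂ) * (x:ℂ))) ∂(μ t' : Measure ℝ))
        - (∫ x : ℝ, Complex.exp (-(Complex.I * (y:ℂ) * (x:ℂ))) ∂(μ t : Measure ℝ))
        = ∫ s in t..t',
            ∫ x : ℝ, (-(Complex.I * (y:ℂ) * (a s x : ℂ))
                - (1/2 : ℂ) * (y:ℂ)^2 * (b s : ℂ))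
              * Complex.exp (-(Complex.I * (y:ℂ) * (x:ℂ))) ∂(μ s : Measure ℝ)) :
    ∀ φ : SchwartzMap ℝ ℝ, ∀ t ∈ Set.Ioo (0:ℝ) T,
      HasDerivAt (fun s => ∫ x : ℝ, φ x ∂(μ s : Measure ℝ))
        (∫ x : ℝ, (a t x * deriv (φ : ℝ → ℝ) x
            + (1/2) * b t * deriv (deriv (φ : ℝ → ℝ)) x) ∂(μ t : Measure ℝ)) t := by
  intro φ t ht
  obtain ⟨C, hC⟩ := ha_bdd
  let p : ℝ → ℝ := fun s ↦ Set.projIcc 0 T hT.le s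
  have hp : Continuous p := continuous_subtype_val.comp continuous_projIcc
  have hp_mem (s : ℝ) : p s ∈ Set.Icc 0 T := (Set.projIcc 0 T hT.le s).2
  have hp_eq {s : ℝ} (hs : s ∈ Set.Icc 0 T) : p s = s := by
    simp [p, Set.projIcc_of_mem hT.le hs]
  have ha' : Continuous (Function.uncurry fun s x ↦ a (p s) x) :=
    ha_cont.comp_continuous (by fun_prop : Continuous fun q : ℝ × ℝ ↦ (p q.1, q.2))
      fun q ↦ ⟨hp_mem q.1, Set.mem_univ _⟩
  have hb' : Continuous fun s ↦ b (p s) := hb.comp_continuous hp hp_mem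
  have hμ' : Continuous fun s ↦ μ (p s) := hμ_cont.comp_continuous hp hp_mem
  obtain ⟨B, hB⟩ := isCompact_Icc.exists_bound_of_continuousOn hb
  let φ₁ := SchwartzMap.derivCLM ℝ ℝ φ
  let φ₂ := SchwartzMap.derivCLM ℝ ℝ φ₁
  let G : ℝ → ℝ := fun s ↦ ∫ x, (a (p s) x * deriv φ x + (1/2) * b (p s) * deriv (deriv φ) x)
    ∂(μ (p s) : Measure ℝ)
  have hG : Continuous G := by
    obtain ⟨K₁, hK₁⟩ := φ₁.toBoundedContinuousFunction.bddAbove_range_norm_comp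
    obtain ⟨K₂, hK₂⟩ := φ₂.toBoundedContinuousFunction.bddAbove_range_norm_comp
    have h₁ (x : ℝ) : |deriv φ x| ≤ K₁ := hK₁ ⟨x, rfl⟩
    have h₂ (x : ℝ) : |deriv (deriv φ) x| ≤ K₂ := hK₂ ⟨x, rfl⟩
    have hC0 : 0 ≤ C := (abs_nonneg _).trans (hC (p 0) (hp_mem 0) 0)
    have hB0 : 0 ≤ B := (norm_nonneg _).trans (hB (p 0) (hp_mem 0))
    refine continuous_integral_of_weaklyContinuous hμ' (C := C * K₁ + (1/2) * B * K₂) ?_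
      fun s x ↦ (norm_add_le _ _).trans ?_
    · exact (ha'.mul (φ₁.continuous.comp continuous_snd)).add
        ((continuous_const.mul (hb'.comp continuous_fst)).mul (φ₂.continuous.comp continuous_snd))
    · simp only [norm_mul, Real.norm_eq_abs]
      rw [abs_of_pos (by norm_num : (0 : ℝ) < 1/2)]
      gcongr
      exacts [hC _ (hp_mem s) x, h₁ x, hB _ (hp_mem s), h₂ x]
  let Φ : SchwartzMap ℝ ℂ := SchwartzMap.postcompCLM Complex.ofRealCLM φ
  have hΦ (x : ℝ) : Φ x = (φ x : ℂ) := rfl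
  have hΦ₁ (x : ℝ) : deriv Φ x = ((deriv (φ : ℝ → ℝ) x : ℝ) : ℂ) :=
    (φ.differentiableAt.hasDerivAt.ofReal_comp).deriv
  have hΦ₂ (x : ℝ) : deriv (deriv Φ) x = ((deriv (deriv (φ : ℝ → ℝ)) x : ℝ) : ℂ) := by
    rw [funext hΦ₁]
    exact ((φ₁.differentiableAt (x := x)).hasDerivAt.ofReal_comp).deriv
  have hint {s : ℝ} (hs : s ∈ Set.Icc 0 T) :
      ∫ x, φ x ∂(μ s : Measure ℝ) = ∫ x, φ x ∂(μ 0 : Measure ℝ) + ∫ r in (0:ℝ)..s, G r := by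
    have h0 : (0 : ℝ) ∈ Set.Icc 0 T := ⟨le_rfl, hT.le⟩
    have h := integral_schwartz_sub_eq (fun s x ↦ a (p s) x) (fun s ↦ b (p s)) (fun s ↦ μ (p s))
      ha' (fun s x ↦ hC _ (hp_mem s) x) hb' (fun s ↦ hB _ (hp_mem s)) hμ' (t := 0) (t' := s)
      (fun y ↦ by
        simp only [hp_eq hs, hp_eq h0]
        rw [hchar 0 s le_rfl hs.1 hs.2 y]
        refine intervalIntegral.integral_congr fun r hr ↦ ?_
        rw [Set.uIcc_of_le hs.1] at hr
        simp only [hp_eq ⟨hr.1, hr.2.trans hs.2⟩]) Φ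
    simp only [hp_eq hs, hp_eq h0, hΦ, hΦ₁, hΦ₂] at h
    have hGc (r : ℝ) : ∫ x, ((a (p r) x : ℂ) * (deriv (φ : ℝ → ℝ) x : ℝ)
        + (1/2) * (b (p r) : ℂ) * (deriv (deriv (φ : ℝ → ℝ)) x : ℝ)) ∂(μ (p r) : Measure ℝ) = (G r : ℂ) := by
      simp only [G, ← integral_complex_ofReal]
      push_cast
      rfl
    simp only [hGc, intervalIntegral.integral_ofReal, integral_complex_ofReal] at h
    rw [← sub_eq_iff_eq_add']
    exact_mod_cast h
  have hderiv : HasDerivAt (fun s ↦ ∫ x, φ x ∂(μ 0 : Measure ℝ) + ∫ r in (0:ℝ)..s, G r) (G t) t :=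
    (hG.integral_hasStrictDerivAt 0 t).hasDerivAt.const_add _
  have hGt : G t = ∫ x : ℝ, (a t x * deriv (φ : ℝ → ℝ) x
      + (1/2) * b t * deriv (deriv (φ : ℝ → ℝ)) x) ∂(μ t : Measure ℝ) := by
    simp only [G, hp_eq (Set.Ioo_subset_Icc_self ht)]
  rw [← hGt]
  refine hderiv.congr_of_eventuallyEq ?_
  filter_upwards [Ioo_mem_nhds ht.1 ht.2] with s hs
  exact hint (Set.Ioo_subset_Icc_self hs)
end
end
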